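/- Parity and sign constraints on the invariants: for every permutation σ of S_n, the number of even elements of λ(σ) (counted with multiplicity) is even; equivalently n − |λ(σ)| is odd. Moreover s(σ) = 0 if and only if λ(σ) contains at least one even element. -/

import Mathlib

namespace Rauzy

/-- Darts: `Sum.inl i` is the bottom point of (0-indexed) position `i`,
`Sum.inr j` is the top point of (0-indexed) position `j`. -/
abbrev Darts (n : ℕ) := Fin n ⊕ Fin n

/-- The chord involution of the diagram of `σ`: bottom point `i` ↔ top point `σ i`. -/
def chordInv {n : ℕ} (σ : Equiv.Perm (Fin n)) : Equiv.Perm (Darts n) :=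
  (Equiv.sumCongr (σ : Fin n ≃ Fin n) (σ⁻¹ : Fin n ≃ Fin n)).trans (Equiv.sumComm _ _)

/-- Coding of the `2n` points, in clockwise order `b_1, …, b_n, t_n, …, t_1`, by `Fin (n + n)`. -/
def circCode (n : ℕ) : Darts n ≃ Fin (n + n) :=
  (Equiv.sumCongr (Equiv.refl (Fin n)) (Fin.revPerm : Equiv.Perm (Fin n))).trans finSumFinEquiv

/-- Clockwise successor among the `2n` circle points. -/
def nextPoint (n : ℕ) : Equiv.Perm (Darts n) :=
  ((circCode n).trans (finRotate (n + n))).trans (circCode n).symm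

/-- The face (boundary walk) permutation of the one-vertex ribbon graph whose chords are
the edges of `σ`; the faces of the ribbon graph are the orbits of this permutation. -/
def facePerm {n : ℕ} (σ : Equiv.Perm (Fin n)) : Equiv.Perm (Darts n) :=
  (chordInv σ).trans (nextPoint n)

/-- The step made from dart `p` traverses the circle arc whose clockwise starting point is
`chordInv σ p`; this arc is one of the `n - 1` (proper) top arcs exactly when that point is a
top point other than the leftmost one. -/
def isTopStart {n : ℕ} (σ : Equiv.Perm (Fin n)) (p : Darts n) : Bool :=
  match chordInv σ p with
  | Sum.inl _ => false
  | Sum.inr j => decide (1 ≤ (j : ℕ))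

/-- The face (orbit of the face permutation) containing the dart `p`. -/
def faceOf {n : ℕ} (σ : Equiv.Perm (Fin n)) (p : Darts n) : Finset (Darts n) :=
  Finset.univ.filter fun q => ∃ k : Fin (n + n), ((facePerm σ) ^ (k : ℕ)) p = q

/-- The length of a face: the number of top arcs on its boundary. -/
def faceLen {n : ℕ} (σ : Equiv.Perm (Fin n)) (F : Finset (Darts n)) : ℕ :=
  (F.filter fun q => isTopStart σ q = true).card

/-- The cycle invariant `λ(σ)`: the multiset of the lengths of the cycles (faces) of `σ`. -/
def cycleInv {n : ℕ} (σ : Equiv.Perm (Fin n)) : Multiset ℕ :=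
  (Finset.univ.image fun p => faceOf σ p).val.map (faceLen σ)

/-- `χ(S)`: the number of pairs `i < j` in `S` with `σ i > σ j`. -/
def inversions {n : ℕ} (σ : Equiv.Perm (Fin n)) (S : Finset (Fin n)) : ℕ :=
  ((S ×ˢ S).filter fun p => p.1 < p.2 ∧ σ p.2 < σ p.1).card

/-- `A(σ) = Σ_{S ⊆ {1,…,n}} (-1)^{|S| + χ(S)}`. -/
def signSum {n : ℕ} (σ : Equiv.Perm (Fin n)) : ℤ :=
  ∑ S : Finset (Fin n), (-1 : ℤ) ^ (S.card + inversions σ S)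

/-- The sign invariant `s(σ) ∈ {-1, 0, 1}`. -/
def signInv {n : ℕ} (σ : Equiv.Perm (Fin n)) : ℤ := (signSum σ).sign

/-- The permutation of the values which fixes `v ≤ a`, sends `v ↦ v + 1` for
`a < v < n` and the largest value to `a + 1` (the identity if `a` is the largest value). -/
def topCycle {n : ℕ} (a : Fin (n + 1)) : Equiv.Perm (Fin (n + 1)) :=
  if a = Fin.last n then 1
  else (Equiv.addLeft (a + 1)).permCongr (Fin.cycleRange (Fin.last n - (a + 1)))

/-- The Rauzy move `L`. -/
def moveL : {n : ℕ} → Equiv.Perm (Fin n) → Equiv.Perm (Fin n)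
  | 0, σ => σ
  | (k + 1), σ => topCycle (σ (Fin.last k)) * σ

/-- The Rauzy move `L'`. -/
def moveL' : {n : ℕ} → Equiv.Perm (Fin n) → Equiv.Perm (Fin n)
  | 0, σ => σ
  | (k + 1), σ => σ * (topCycle (σ⁻¹ (Fin.last k)))⁻¹

/-- Rotation of the diagram by 180 degrees: `rot(σ)(i) = n + 1 - σ⁻¹(n + 1 - i)`. -/
def rotD {n : ℕ} (σ : Equiv.Perm (Fin n)) : Equiv.Perm (Fin n) :=
  (Fin.revPerm : Equiv.Perm (Fin n)) * σ⁻¹ * (Fin.revPerm : Equiv.Perm (Fin n))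

/-- The Rauzy move `R = rot ∘ L ∘ rot`. -/
def moveR {n : ℕ} (σ : Equiv.Perm (Fin n)) : Equiv.Perm (Fin n) := rotD (moveL (rotD σ))

/-- The Rauzy move `R' = rot ∘ L' ∘ rot`. -/
def moveR' {n : ℕ} (σ : Equiv.Perm (Fin n)) : Equiv.Perm (Fin n) := rotD (moveL' (rotD σ))

/-- One step of the extended Rauzy dynamics. -/
def RauzyStep {n : ℕ} (σ τ : Equiv.Perm (Fin n)) : Prop :=
  τ = moveL σ ∨ τ = moveL' σ ∨ τ = moveR σ ∨ τ = moveR' σ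

/-- Two permutations are connected (are in the same class) under the extended Rauzy dynamics. -/
def RauzyConnected {n : ℕ} (σ τ : Equiv.Perm (Fin n)) : Prop :=
  Relation.EqvGen RauzyStep σ τ

/-- The exceptional class is the class of the identity permutation. -/
def Exceptional {n : ℕ} (σ : Equiv.Perm (Fin n)) : Prop := RauzyConnected σ 1

/-- Reduction of `σ` by the edge `(i, σ i)`: delete bottom point `i` and top point `σ i`
and renumber the remaining points in order. -/
def reduceAt {n : ℕ} (σ : Equiv.Perm (Fin (n + 1))) (i : Fin (n + 1)) : Equiv.Perm (Fin n) :=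
  Equiv.removeNone
    (((finSuccEquiv' i).symm.trans (σ : Fin (n + 1) ≃ Fin (n + 1))).trans (finSuccEquiv' (σ i)))

/-- Insertion of one new edge in `σ`, with bottom endpoint at (new) position `b` and top
endpoint at (new) position `t`. -/
def insertAt {n : ℕ} (σ : Equiv.Perm (Fin (n + 1))) (b t : Fin (n + 2)) :
    Equiv.Perm (Fin (n + 2)) :=
  ((finSuccEquiv' b).trans (Equiv.optionCongr σ)).trans (finSuccEquiv' t).symm

/-- The face containing the top arc whose clockwise starting point is the top point `j`
(for `1 ≤ j` this is the top arc lying immediately to the left of top point `j`). -/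
def faceOfTopPoint {n : ℕ} (σ : Equiv.Perm (Fin n)) (j : Fin n) : Finset (Darts n) :=
  faceOf σ (chordInv σ (Sum.inr j))

/-- The face containing the bottom arc between bottom points `i` and `i + 1`. -/
def faceOfBotPoint {n : ℕ} (σ : Equiv.Perm (Fin n)) (i : Fin n) : Finset (Darts n) :=
  faceOf σ (chordInv σ (Sum.inl i))

/-- The top principal cycle: the face containing the top arc between top points 1 and 2. -/
def topPrincipalFace {n : ℕ} (σ : Equiv.Perm (Fin (n + 1))) : Finset (Darts (n + 1)) :=
  faceOfTopPoint σ 1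

/-- The bottom principal cycle: the face containing the bottom arc between bottom points
1 and 2. -/
def botPrincipalFace {n : ℕ} (σ : Equiv.Perm (Fin (n + 1))) : Finset (Darts (n + 1)) :=
  faceOfBotPoint σ 0

def topPrincipalLen {n : ℕ} (σ : Equiv.Perm (Fin (n + 1))) : ℕ :=
  faceLen σ (topPrincipalFace σ)

def botPrincipalLen {n : ℕ} (σ : Equiv.Perm (Fin (n + 1))) : ℕ :=
  faceLen σ (botPrincipalFace σ)

/-- The dart whose step traverses the top principal arc. -/
def topPrincipalDart {n : ℕ} (σ : Equiv.Perm (Fin (n + 1))) : Darts (n + 1) :=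
  chordInv σ (Sum.inr 1)

/-- The dart whose step traverses the bottom principal arc. -/
def botPrincipalDart {n : ℕ} (σ : Equiv.Perm (Fin (n + 1))) : Darts (n + 1) :=
  chordInv σ (Sum.inl 0)

open scoped Classical in
/-- When the top and bottom principal arcs lie on a common cycle, the number of top arcs on
the portion of that cycle going from the bottom principal arc to the top principal arc
(inclusive of the latter). -/
noncomputable def portionA {n : ℕ} (σ : Equiv.Perm (Fin (n + 1))) : ℕ :=
  if h : ∃ k, 0 < k ∧ ((facePerm σ) ^ k) (botPrincipalDart σ) = topPrincipalDart σ then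
    ((Finset.Icc 1 (Nat.find h)).filter fun e =>
      isTopStart σ (((facePerm σ) ^ e) (botPrincipalDart σ)) = true).card
  else 0

open scoped Classical in
/-- The number of top arcs on the other portion, from the top principal arc (inclusive)
to the bottom principal arc. -/
noncomputable def portionB {n : ℕ} (σ : Equiv.Perm (Fin (n + 1))) : ℕ :=
  if h : ∃ k, 0 < k ∧ ((facePerm σ) ^ k) (topPrincipalDart σ) = botPrincipalDart σ then
    ((Finset.range (Nat.find h)).filter fun e =>
      isTopStart σ (((facePerm σ) ^ e) (topPrincipalDart σ)) = true).card
  else 0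

/-- A standard permutation has type `X(r, i)` if its top and bottom principal cycles are
distinct, of lengths `r` and `i` respectively. -/
def TypeX {n : ℕ} (σ : Equiv.Perm (Fin (n + 1))) (r i : ℕ) : Prop :=
  topPrincipalFace σ ≠ botPrincipalFace σ ∧ topPrincipalLen σ = r ∧ botPrincipalLen σ = i

/-- A standard permutation has type `H(a, b)` if its top and bottom principal cycles
coincide, and the two portions into which the two principal arcs divide this common cycle
carry `a` resp. `b` top arcs. -/
def TypeH {n : ℕ} (σ : Equiv.Perm (Fin (n + 1))) (a b : ℕ) : Prop :=
  topPrincipalFace σ = botPrincipalFace σ ∧ portionA σ = a ∧ portionB σ = b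

instance {n : ℕ} (σ : Equiv.Perm (Fin (n + 1))) (r i : ℕ) : Decidable (TypeX σ r i) :=
  inferInstanceAs (Decidable
    (topPrincipalFace σ ≠ botPrincipalFace σ ∧ topPrincipalLen σ = r ∧ botPrincipalLen σ = i))

noncomputable instance {n : ℕ} (σ : Equiv.Perm (Fin (n + 1))) (a b : ℕ) : Decidable (TypeH σ a b) :=
  inferInstanceAs (Decidable
    (topPrincipalFace σ = botPrincipalFace σ ∧ portionA σ = a ∧ portionB σ = b))

/-- The step made from dart `p` traverses one of the two side arcs (the arc from `t_1` to
`b_1`, or the arc from `b_n` to `t_n`). -/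
def isSideStart {n : ℕ} (σ : Equiv.Perm (Fin (n + 1))) (p : Darts (n + 1)) : Prop :=
  chordInv σ p = Sum.inr 0 ∨ chordInv σ p = Sum.inl (Fin.last n)

/-- Given labelling data `f`, the dart of the arc carrying label `(m, k, j)`: for odd `j` the
top arc `t_{j,m,k}` whose clockwise starting top point is `f m k j`, for even `j` the bottom
arc `b_{j,m,k}` starting at bottom point `f m k j`. -/
def labDart {n : ℕ} (σ : Equiv.Perm (Fin (n + 1))) (f : ℕ → ℕ → ℕ → Fin (n + 1))
    (m k j : ℕ) : Darts (n + 1) :=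
  if j % 2 = 1 then chordInv σ (Sum.inr (f m k j)) else chordInv σ (Sum.inl (f m k j))

/-- `(m, k, j)` is a valid arc label: `m` occurs in `λ(σ)` with multiplicity at least `k ≥ 1`,
and `j < 2m`. -/
def ValidLabel {n : ℕ} (σ : Equiv.Perm (Fin (n + 1))) (m k j : ℕ) : Prop :=
  1 ≤ k ∧ k ≤ (cycleInv σ).count m ∧ j < 2 * m

/-- `f` is a consistent labelling of the arcs of `σ`: for each cycle of length `m`
(the `k`-th among those), its top arcs are labelled `t_{1,m,k}, t_{3,m,k}, …` and its bottom
arcs `b_{0,m,k}, b_{2,m,k}, …`, interleaved, following the cyclic order of the cycle. -/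
def IsConsistentLabelling {n : ℕ} (σ : Equiv.Perm (Fin (n + 1)))
    (f : ℕ → ℕ → ℕ → Fin (n + 1)) : Prop :=
  (∀ m k j, ValidLabel σ m k j → j % 2 = 1 → 1 ≤ (f m k j : ℕ)) ∧
  (∀ m k j, ValidLabel σ m k j → j % 2 = 0 → (f m k j : ℕ) < n) ∧
  (∀ m k j, ValidLabel σ m k j →
    faceOf σ (labDart σ f m k j) = faceOf σ (labDart σ f m k 0)) ∧
  (∀ m k j, ValidLabel σ m k j → faceLen σ (faceOf σ (labDart σ f m k j)) = m) ∧
  (∀ m k j m' k' j', ValidLabel σ m k j → ValidLabel σ m' k' j' →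
    labDart σ f m k j = labDart σ f m' k' j' → m = m' ∧ k = k' ∧ j = j') ∧
  (∀ m k m' k', ValidLabel σ m k 0 → ValidLabel σ m' k' 0 →
    faceOf σ (labDart σ f m k 0) = faceOf σ (labDart σ f m' k' 0) → m = m' ∧ k = k') ∧
  (∀ p : Darts (n + 1), ¬ isSideStart σ p → ∃ m k j, ValidLabel σ m k j ∧ labDart σ f m k j = p) ∧
  (∀ m k j, ValidLabel σ m k j → ∃ d, 0 < d ∧
    ((facePerm σ) ^ d) (labDart σ f m k j) = labDart σ f m k ((j + 1) % (2 * m)) ∧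
    ∀ e, 0 < e → e < d → isSideStart σ (((facePerm σ) ^ e) (labDart σ f m k j)))


/-! ### Gap permutations -/

/-- `σ` acting on the gaps, a gap being identified with the edge on its left. -/
def hatP {n : ℕ} (σ : Equiv.Perm (Fin (n + 1))) : Equiv.Perm (Fin (n + 2)) :=
  (finSuccEquiv (n + 1)).symm.permCongr (Equiv.optionCongr σ)

/-- `σ` acting on the gaps, a gap being identified with the edge on its right. -/
def chkP {n : ℕ} (σ : Equiv.Perm (Fin (n + 1))) : Equiv.Perm (Fin (n + 2)) :=
  (finSuccEquivLast (n := n + 1)).symm.permCongr (Equiv.optionCongr σ)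

lemma hatP_zero {n : ℕ} (σ : Equiv.Perm (Fin (n + 1))) : hatP σ 0 = 0 := by
  simp [hatP, Equiv.permCongr_apply]

lemma hatP_succ {n : ℕ} (σ : Equiv.Perm (Fin (n + 1))) (i : Fin (n + 1)) :
    hatP σ i.succ = (σ i).succ := by
  simp [hatP, Equiv.permCongr_apply]

lemma chkP_last {n : ℕ} (σ : Equiv.Perm (Fin (n + 1))) :
    chkP σ (Fin.last (n + 1)) = Fin.last (n + 1) := by
  simp [chkP, Equiv.permCongr_apply]

lemma chkP_castSucc {n : ℕ} (σ : Equiv.Perm (Fin (n + 1))) (i : Fin (n + 1)) :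
    chkP σ i.castSucc = (σ i).castSucc := by
  simp [chkP, Equiv.permCongr_apply]

/-- The face permutation on bottom gaps. -/
def gapP {n : ℕ} (σ : Equiv.Perm (Fin (n + 1))) : Equiv.Perm (Fin (n + 2)) :=
  (chkP σ)⁻¹ * hatP σ

lemma chkP_gapP {n : ℕ} (σ : Equiv.Perm (Fin (n + 1))) (x : Fin (n + 2)) :
    chkP σ (gapP σ x) = hatP σ x := by
  simp [gapP]

/-- The cycle of gaps containing `i`. -/
def faceG {n : ℕ} (σ : Equiv.Perm (Fin (n + 1))) (i : Fin (n + 2)) : Finset (Fin (n + 2)) :=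
  Finset.univ.filter fun j => (gapP σ).SameCycle i j

lemma mem_faceG {n : ℕ} (σ : Equiv.Perm (Fin (n + 1))) (i j : Fin (n + 2)) :
    j ∈ faceG σ i ↔ (gapP σ).SameCycle i j := by simp [faceG]

lemma finRotate_val {m : ℕ} (x : Fin m) (h : (x : ℕ) + 1 < m) :
    ((finRotate m x : Fin m) : ℕ) = x + 1 := by
  cases m with
  | zero => omega
  | succ k =>
    apply coe_finRotate_of_ne_last
    rintro rfl
    simp at h

lemma next_inl_castSucc {n : ℕ} (i : Fin n) :
    nextPoint (n + 1) (Sum.inl i.castSucc) = Sum.inl i.succ := by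
  unfold nextPoint
  simp only [Equiv.trans_apply]
  rw [Equiv.symm_apply_eq]
  apply Fin.ext
  have := i.isLt
  rw [finRotate_val]
  · simp [circCode]
  · simp [circCode]
    omega

lemma next_inl_last {n : ℕ} :
    nextPoint (n + 1) (Sum.inl (Fin.last n)) = Sum.inr (Fin.last n) := by
  unfold nextPoint
  simp only [Equiv.trans_apply]
  rw [Equiv.symm_apply_eq]
  apply Fin.ext
  rw [finRotate_val]
  · simp [circCode]
  · simp [circCode]

lemma next_inr_succ {n : ℕ} (j : Fin n) :
    nextPoint (n + 1) (Sum.inr j.succ) = Sum.inr j.castSucc := by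
  unfold nextPoint
  simp only [Equiv.trans_apply]
  rw [Equiv.symm_apply_eq]
  apply Fin.ext
  have := j.isLt
  rw [finRotate_val]
  · simp [circCode, Fin.val_rev]
    omega
  · simp [circCode, Fin.val_rev]
    omega

lemma next_inr_zero {n : ℕ} :
    nextPoint (n + 1) (Sum.inr 0) = Sum.inl 0 := by
  unfold nextPoint
  simp only [Equiv.trans_apply]
  rw [Equiv.symm_apply_eq]
  have : circCode (n + 1) (Sum.inr 0) = Fin.last (n + 1 + n) := by
    apply Fin.ext
    simp [circCode]
  rw [this]
  erw [finRotate_last]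
  apply Fin.ext
  simp [circCode]

lemma chordInv_inl {n : ℕ} (σ : Equiv.Perm (Fin n)) (i : Fin n) :
    chordInv σ (Sum.inl i) = Sum.inr (σ i) := rfl

lemma chordInv_inr {n : ℕ} (σ : Equiv.Perm (Fin n)) (i : Fin n) :
    chordInv σ (Sum.inr i) = Sum.inl (σ⁻¹ i) := rfl

lemma chordInv_chordInv {n : ℕ} (σ : Equiv.Perm (Fin n)) (p : Darts n) :
    chordInv σ (chordInv σ p) = p := by
  rcases p with i | i <;> simp [chordInv_inl, chordInv_inr]

/-- The gap of the arc with given starting point. -/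
def arcGap {n : ℕ} (σ : Equiv.Perm (Fin (n + 1))) : Darts (n + 1) → Fin (n + 2)
  | Sum.inl i => i.succ
  | Sum.inr j => (hatP σ)⁻¹ j.castSucc

def dartGap {n : ℕ} (σ : Equiv.Perm (Fin (n + 1))) (p : Darts (n + 1)) : Fin (n + 2) :=
  arcGap σ (chordInv σ p)

/-- A dart on each gap. -/
def gapDart {n : ℕ} (σ : Equiv.Perm (Fin (n + 1))) : Fin (n + 2) → Darts (n + 1) :=
  Fin.cases (chordInv σ (Sum.inr 0)) (fun i => chordInv σ (Sum.inl i))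

lemma hatP_inv_succ {n : ℕ} (σ : Equiv.Perm (Fin (n + 1))) (i : Fin (n + 1)) :
    (hatP σ)⁻¹ i.succ = (σ⁻¹ i).succ := by
  rw [Equiv.Perm.inv_eq_iff_eq, hatP_succ]; simp

lemma hatP_inv_zero {n : ℕ} (σ : Equiv.Perm (Fin (n + 1))) :
    (hatP σ)⁻¹ 0 = 0 := by
  rw [Equiv.Perm.inv_eq_iff_eq, hatP_zero]

lemma gapP_inv_apply {n : ℕ} (σ : Equiv.Perm (Fin (n + 1))) (x : Fin (n + 2)) :
    (gapP σ)⁻¹ x = (hatP σ)⁻¹ (chkP σ x) := by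
  simp [gapP, mul_inv_rev]

lemma dartGap_gapDart {n : ℕ} (σ : Equiv.Perm (Fin (n + 1))) (i : Fin (n + 2)) :
    dartGap σ (gapDart σ i) = i := by
  refine Fin.cases ?_ (fun i => ?_) i
  · simp only [dartGap, gapDart, Fin.cases_zero, chordInv_chordInv, arcGap]
    exact hatP_inv_zero σ
  · simp only [dartGap, gapDart, Fin.cases_succ, chordInv_chordInv, arcGap]

lemma arc_step_inl {n : ℕ} (σ : Equiv.Perm (Fin (n + 1))) (i : Fin (n + 1)) :
    arcGap σ (chordInv σ (nextPoint (n + 1) (Sum.inl i))) = (gapP σ)⁻¹ i.succ := by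
  rw [gapP_inv_apply]
  refine Fin.lastCases ?_ (fun i => ?_) i
  · rw [next_inl_last, chordInv_inr, Fin.succ_last, chkP_last, ← Fin.succ_last, hatP_inv_succ]
    rfl
  · rw [next_inl_castSucc, chordInv_inl, Fin.succ_castSucc, chkP_castSucc]
    rfl

lemma arc_step_inr_zero {n : ℕ} (σ : Equiv.Perm (Fin (n + 1))) :
    arcGap σ (chordInv σ (nextPoint (n + 1) (Sum.inr 0))) = (gapP σ)⁻¹ 0 := by
  rw [gapP_inv_apply, next_inr_zero, chordInv_inl,
    show (0 : Fin (n + 2)) = (0 : Fin (n + 1)).castSucc from rfl, chkP_castSucc]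
  rfl

lemma facePerm_apply {n : ℕ} (σ : Equiv.Perm (Fin n)) (p : Darts n) :
    facePerm σ p = nextPoint n (chordInv σ p) := rfl

lemma arc_step_inr_succ {n : ℕ} (σ : Equiv.Perm (Fin (n + 1))) (j : Fin n) :
    arcGap σ (chordInv σ (nextPoint (n + 1) (Sum.inr j.succ))) = arcGap σ (Sum.inr j.succ) := by
  rw [next_inr_succ, chordInv_inr]
  simp only [arcGap]
  rw [← hatP_inv_succ, Fin.succ_castSucc]

lemma dartGap_facePerm {n : ℕ} (σ : Equiv.Perm (Fin (n + 1))) (p : Darts (n + 1)) :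
    (gapP σ).SameCycle (dartGap σ p) (dartGap σ (facePerm σ p)) := by
  simp only [dartGap, facePerm_apply]
  generalize chordInv σ p = r
  rcases r with i | j
  · rw [arc_step_inl]
    exact (Equiv.Perm.sameCycle_symm_apply_right).2 (Equiv.Perm.SameCycle.refl _ _)
  · refine Fin.cases ?_ (fun j => ?_) j
    · rw [arc_step_inr_zero]
      have : arcGap σ (Sum.inr 0) = 0 := hatP_inv_zero σ
      rw [this]
      exact (Equiv.Perm.sameCycle_symm_apply_right).2 (Equiv.Perm.SameCycle.refl _ _)
    · rw [arc_step_inr_succ]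

/-- A relation-valued invariant along a permutation. -/
lemma sameCycle_lift {α β : Type*} [Finite α] (f : Equiv.Perm α) (g : Equiv.Perm β) (u : α → β)
    (h : ∀ x, g.SameCycle (u x) (u (f x))) {x y : α} (hxy : f.SameCycle x y) :
    g.SameCycle (u x) (u y) := by
  obtain ⟨i, rfl⟩ := hxy.exists_nat_pow_eq
  clear hxy
  induction i with
  | zero => exact Equiv.Perm.SameCycle.refl _ _
  | succ k ih =>
    rw [pow_succ', Equiv.Perm.mul_apply]
    exact ih.trans (h _)

lemma sameCycle_gapDart_dartGap {n : ℕ} (σ : Equiv.Perm (Fin (n + 1))) (p : Darts (n + 1)) :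
    (facePerm σ).SameCycle p (gapDart σ (dartGap σ p)) := by
  have hp : p = chordInv σ (chordInv σ p) := (chordInv_chordInv σ p).symm
  generalize chordInv σ p = r at hp
  subst hp
  rcases r with i | j
  · simp only [dartGap, chordInv_chordInv, arcGap, gapDart, Fin.cases_succ]
    exact Equiv.Perm.SameCycle.refl _ _
  · refine Fin.cases ?_ (fun j => ?_) j
    · have : dartGap σ (chordInv σ (Sum.inr 0)) = 0 := by
        rw [dartGap, chordInv_chordInv]; exact hatP_inv_zero σ
      rw [this]
      exact Equiv.Perm.SameCycle.refl _ _
    · have h1 : facePerm σ (chordInv σ (Sum.inr j.succ)) = Sum.inr j.castSucc := by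
        rw [facePerm_apply, chordInv_chordInv, next_inr_succ]
      have h2 : dartGap σ (chordInv σ (Sum.inr j.succ)) = (σ⁻¹ j.castSucc).succ := by
        rw [dartGap, chordInv_chordInv, ← hatP_inv_succ, Fin.succ_castSucc]; rfl
      have h3 : gapDart σ (dartGap σ (chordInv σ (Sum.inr j.succ))) =
          facePerm σ (chordInv σ (Sum.inr j.succ)) := by
        rw [h1, h2]
        simp only [gapDart, Fin.cases_succ, chordInv_inl]
        simp
      rw [h3, Equiv.Perm.sameCycle_apply_right]

lemma gapDart_gapP_inv {n : ℕ} (σ : Equiv.Perm (Fin (n + 1))) (i : Fin (n + 2)) :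
    (facePerm σ).SameCycle (gapDart σ i) (gapDart σ ((gapP σ)⁻¹ i)) := by
  have h : dartGap σ (facePerm σ (gapDart σ i)) = (gapP σ)⁻¹ i := by
    rw [dartGap, facePerm_apply]
    refine Fin.cases ?_ (fun i => ?_) i
    · simp only [gapDart, Fin.cases_zero, chordInv_chordInv]
      exact arc_step_inr_zero σ
    · simp only [gapDart, Fin.cases_succ, chordInv_chordInv]
      exact arc_step_inl σ i
  rw [← h]
  exact Equiv.Perm.SameCycle.trans
    (Equiv.Perm.sameCycle_apply_right.2 (Equiv.Perm.SameCycle.refl _ _))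
    (sameCycle_gapDart_dartGap σ _)

lemma sameCycle_face_iff {n : ℕ} (σ : Equiv.Perm (Fin (n + 1))) (p q : Darts (n + 1)) :
    (facePerm σ).SameCycle p q ↔ (gapP σ).SameCycle (dartGap σ p) (dartGap σ q) := by
  constructor
  · exact sameCycle_lift _ _ (dartGap σ) (dartGap_facePerm σ)
  · intro h
    rw [← Equiv.Perm.sameCycle_inv] at h
    have := sameCycle_lift _ (facePerm σ) (gapDart σ) (gapDart_gapP_inv σ) h
    exact ((sameCycle_gapDart_dartGap σ p).trans this).trans (sameCycle_gapDart_dartGap σ q).symm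

lemma mem_faceOf {n : ℕ} (σ : Equiv.Perm (Fin (n + 1))) (p q : Darts (n + 1)) :
    q ∈ faceOf σ p ↔ (facePerm σ).SameCycle p q := by
  simp only [faceOf, Finset.mem_filter, Finset.mem_univ, true_and]
  constructor
  · rintro ⟨k, rfl⟩
    exact Equiv.Perm.sameCycle_pow_right.2 (Equiv.Perm.SameCycle.refl _ _)
  · intro h
    by_cases hp : p ∈ (facePerm σ).support
    · obtain ⟨i, hi, h⟩ := h.exists_pow_eq_of_mem_support hp
      refine ⟨⟨i, hi.trans_le ?_⟩, h⟩
      refine (Finset.card_le_univ _).trans ?_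
      simp
    · rw [Equiv.Perm.notMem_support] at hp
      exact ⟨⟨0, by omega⟩, h.eq_of_left hp⟩

/-- Pull a set of gaps back to darts. -/
def pullG {n : ℕ} (σ : Equiv.Perm (Fin (n + 1))) (H : Finset (Fin (n + 2))) :
    Finset (Darts (n + 1)) :=
  Finset.univ.filter fun p => dartGap σ p ∈ H

lemma pullG_injective {n : ℕ} (σ : Equiv.Perm (Fin (n + 1))) :
    Function.Injective (pullG σ) := by
  intro H K h
  ext i
  have := Finset.ext_iff.1 h (gapDart σ i)
  simpa [pullG, dartGap_gapDart] using this

lemma faceOf_eq {n : ℕ} (σ : Equiv.Perm (Fin (n + 1))) (p : Darts (n + 1)) :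
    faceOf σ p = pullG σ (faceG σ (dartGap σ p)) := by
  ext q
  rw [mem_faceOf, sameCycle_face_iff]
  simp [pullG, mem_faceG]

/-- The set of all gap cycles. -/
def facesG {n : ℕ} (σ : Equiv.Perm (Fin (n + 1))) : Finset (Finset (Fin (n + 2))) :=
  Finset.univ.image (faceG σ)

lemma cycleInv_eq {n : ℕ} (σ : Equiv.Perm (Fin (n + 1))) :
    cycleInv σ = (facesG σ).val.map (fun H => faceLen σ (pullG σ H)) := by
  have h : (Finset.univ.image fun p => faceOf σ p) =
      (facesG σ).map ⟨pullG σ, pullG_injective σ⟩ := by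
    ext F
    simp only [Finset.mem_image, Finset.mem_univ, true_and, Finset.mem_map, facesG,
      Function.Embedding.coeFn_mk, exists_exists_eq_and]
    constructor
    · rintro ⟨p, rfl⟩
      exact ⟨dartGap σ p, (faceOf_eq σ p).symm⟩
    · rintro ⟨i, rfl⟩
      exact ⟨gapDart σ i, by rw [faceOf_eq, dartGap_gapDart]⟩
  rw [cycleInv, h, Finset.map_val, Multiset.map_map]
  rfl

lemma faceLen_pullG {n : ℕ} (σ : Equiv.Perm (Fin (n + 1))) (H : Finset (Fin (n + 2)))
    (hH : ∀ x, gapP σ x ∈ H ↔ x ∈ H) :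
    faceLen σ (pullG σ H) + ((if (0 : Fin (n + 2)) ∈ H then 1 else 0)
      + (if Fin.last (n + 1) ∈ H then 1 else 0)) = H.card := by
  have h0 : faceLen σ (pullG σ H) =
      (Finset.univ.filter fun j : Fin n => (hatP σ)⁻¹ j.succ.castSucc ∈ H).card := by
    symm
    unfold faceLen
    apply Finset.card_bij (fun j _ => chordInv σ (Sum.inr j.succ))
    · intro j hj
      simp only [Finset.mem_filter, Finset.mem_univ, true_and, pullG] at hj ⊢
      refine ⟨?_, ?_⟩
      · rw [dartGap, chordInv_chordInv]; exact hj
      · rw [isTopStart, chordInv_chordInv]; simp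
    · intro a _ b _ hab
      simpa using hab
    · intro p hp
      simp only [Finset.mem_filter, Finset.mem_univ, true_and, pullG] at hp
      obtain ⟨h1, h2⟩ := hp
      rw [dartGap] at h1
      rw [isTopStart] at h2
      rcases hr : chordInv σ p with i | j
      · rw [hr] at h2; simp at h2
      · rw [hr] at h1 h2
        simp only [decide_eq_true_eq] at h2
        have hj : j ≠ 0 := by rintro rfl; simp at h2
        obtain ⟨j', rfl⟩ := Fin.exists_succ_eq.2 hj
        refine ⟨j', by simpa [arcGap] using h1, ?_⟩
        rw [← hr, chordInv_chordInv]
  have h1 : H.card = ∑ x : Fin (n + 2), if (hatP σ)⁻¹ x ∈ H then 1 else 0 := by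
    rw [Equiv.sum_comp (hatP σ)⁻¹ (fun x => if x ∈ H then 1 else 0)]
    simp
  have h2 : ((hatP σ)⁻¹ (Fin.last (n + 1)) ∈ H) ↔ Fin.last (n + 1) ∈ H := by
    rw [← hH]
    have : gapP σ ((hatP σ)⁻¹ (Fin.last (n + 1))) = Fin.last (n + 1) := by
      apply (chkP σ).injective
      rw [chkP_gapP, chkP_last]; simp
    rw [this]
  rw [h1, Fin.sum_univ_castSucc, Fin.sum_univ_succ, h0, Finset.card_filter, Fin.castSucc_zero,
    hatP_inv_zero]
  simp only [h2]
  ring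

/-! ### The quadratic form -/

def iv {n : ℕ} (σ : Equiv.Perm (Fin n)) (i j : Fin n) : ZMod 2 :=
  if i < j ∧ σ j < σ i then 1 else 0

def Qf {n : ℕ} (σ : Equiv.Perm (Fin n)) (x : Fin n → ZMod 2) : ZMod 2 :=
  ∑ i, ∑ j, iv σ i j * (x i * x j)

def Bf {n : ℕ} (σ : Equiv.Perm (Fin n)) (x y : Fin n → ZMod 2) : ZMod 2 :=
  ∑ i, ∑ j, (iv σ i j + iv σ j i) * (x i * y j)

def qf {n : ℕ} (σ : Equiv.Perm (Fin n)) (x : Fin n → ZMod 2) : ZMod 2 :=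
  ∑ i, x i + Qf σ x

lemma Qf_add {n : ℕ} (σ : Equiv.Perm (Fin n)) (x y : Fin n → ZMod 2) :
    Qf σ (x + y) = Qf σ x + Qf σ y + Bf σ x y := by
  have h : ∑ i, ∑ j, iv σ j i * (x i * y j) = ∑ i, ∑ j, iv σ i j * (y i * x j) := by
    rw [Finset.sum_comm]
    refine Finset.sum_congr rfl fun i _ => Finset.sum_congr rfl fun j _ => ?_
    ring
  have h2 : Bf σ x y = ∑ i, ∑ j, iv σ i j * (x i * y j) + ∑ i, ∑ j, iv σ i j * (y i * x j) := by
    rw [← h, ← Finset.sum_add_distrib]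
    refine Finset.sum_congr rfl fun i _ => ?_
    rw [← Finset.sum_add_distrib]
    refine Finset.sum_congr rfl fun j _ => ?_
    ring
  rw [h2]
  simp only [Qf, ← Finset.sum_add_distrib]
  refine Finset.sum_congr rfl fun i _ => Finset.sum_congr rfl fun j _ => ?_
  simp only [Pi.add_apply]
  ring

lemma Bf_self {n : ℕ} (σ : Equiv.Perm (Fin n)) (x : Fin n → ZMod 2) : Bf σ x x = 0 := by
  have h := Qf_add σ x x
  have h0 : x + x = 0 := by
    ext i; exact CharTwo.add_self_eq_zero _
  rw [h0, CharTwo.add_self_eq_zero, zero_add] at h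
  rw [← h]
  simp [Qf]

lemma Bf_add_right {n : ℕ} (σ : Equiv.Perm (Fin n)) (x y z : Fin n → ZMod 2) :
    Bf σ x (y + z) = Bf σ x y + Bf σ x z := by
  simp only [Bf, ← Finset.sum_add_distrib]
  refine Finset.sum_congr rfl fun i _ => Finset.sum_congr rfl fun j _ => ?_
  simp only [Pi.add_apply]
  ring

lemma Bf_add_left {n : ℕ} (σ : Equiv.Perm (Fin n)) (x y z : Fin n → ZMod 2) :
    Bf σ (x + y) z = Bf σ x z + Bf σ y z := by
  simp only [Bf, ← Finset.sum_add_distrib]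
  refine Finset.sum_congr rfl fun i _ => Finset.sum_congr rfl fun j _ => ?_
  simp only [Pi.add_apply]
  ring

lemma qf_add {n : ℕ} (σ : Equiv.Perm (Fin n)) (x y : Fin n → ZMod 2) :
    qf σ (x + y) = qf σ x + qf σ y + Bf σ x y := by
  simp only [qf, Qf_add, Pi.add_apply, Finset.sum_add_distrib]
  ring

def Rad {n : ℕ} (σ : Equiv.Perm (Fin n)) (z : Fin n → ZMod 2) : Prop :=
  ∀ x, Bf σ x z = 0

lemma iv_symm {n : ℕ} (σ : Equiv.Perm (Fin n)) (i j : Fin n) :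
    iv σ i j + iv σ j i = (if j < i then 1 else 0) + (if σ j < σ i then 1 else 0) := by
  unfold iv
  rcases lt_trichotomy i j with h | h | h
  · simp [h, h.not_gt]
  · subst h; simp
  · have hne : σ i ≠ σ j := fun e => h.ne (σ.injective e).symm
    rcases lt_or_gt_of_ne hne with h' | h'
    · simp [h, h.not_gt, h', h'.not_gt]
    · simp [h, h.not_gt, h', h'.not_gt]
      decide

lemma Bf_eq {n : ℕ} (σ : Equiv.Perm (Fin n)) (x z : Fin n → ZMod 2) :
    Bf σ x z = ∑ i, x i * ((∑ j, if j < i then z j else 0) + ∑ j, if σ j < σ i then z j else 0) := by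
  unfold Bf
  refine Finset.sum_congr rfl fun i _ => ?_
  rw [← Finset.sum_add_distrib, Finset.mul_sum]
  refine Finset.sum_congr rfl fun j _ => ?_
  rw [iv_symm]
  split_ifs <;> ring

lemma Rad_iff {n : ℕ} (σ : Equiv.Perm (Fin n)) (z : Fin n → ZMod 2) :
    Rad σ z ↔ ∀ i, (∑ j, if j < i then z j else 0) + ∑ j, (if σ j < σ i then z j else 0) = 0 := by
  constructor
  · intro h i
    have := h (Pi.single i 1)
    rw [Bf_eq, Finset.sum_eq_single i] at this
    · simpa using this
    · intro b _ hb
      simp [hb]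
    · simp
  · intro h x
    rw [Bf_eq]
    exact Finset.sum_eq_zero fun i _ => by rw [h i, mul_zero]

/-! ### Signs -/

def eps (a : ZMod 2) : ℤ := if a = 0 then 1 else -1

lemma eps_add (a b : ZMod 2) : eps (a + b) = eps a * eps b := by
  revert a b; decide

lemma eps_zero : eps 0 = 1 := by decide

lemma eps_one : eps 1 = -1 := by decide

lemma eps_sum {ι : Type*} (s : Finset ι) (f : ι → ZMod 2) :
    eps (∑ i ∈ s, f i) = ∏ i ∈ s, eps (f i) := by
  classical
  induction s using Finset.induction_on with
  | empty => simp [eps_zero]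
  | insert a s ha ih => rw [Finset.sum_insert ha, Finset.prod_insert ha, eps_add, ih]

lemma eps_natCast (m : ℕ) : eps (m : ZMod 2) = (-1) ^ m := by
  induction m with
  | zero => simp [eps_zero]
  | succ k ih => push_cast; rw [eps_add, ih, eps_one, pow_succ]

lemma eps_inj {a b : ZMod 2} (h : eps a = eps b) : a = b := by
  revert a b; decide

lemma zmod2_ne_zero {a : ZMod 2} (h : a ≠ 0) : a = 1 := by
  revert a; decide

lemma signSum_eq {n : ℕ} (σ : Equiv.Perm (Fin n)) :
    signSum σ = ∑ x : Fin n → ZMod 2, eps (qf σ x) := by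
  unfold signSum
  refine Finset.sum_bij' (fun S _ => fun i => if i ∈ S then 1 else 0)
    (fun x _ => Finset.univ.filter fun i => x i = 1) ?_ ?_ ?_ ?_ ?_
  · intros; simp
  · intros; simp
  · intro S _; ext i; simp
  · intro x _
    funext i
    simp only [Finset.mem_filter, Finset.mem_univ, true_and]
    generalize x i = a
    revert a; decide
  · intro S _
    rw [← eps_natCast]
    congr 1
    unfold qf Qf inversions
    rw [Nat.cast_add, Finset.card_filter, Finset.sum_product]
    congr 1
    · simp
    · push_cast
      rw [← Finset.sum_subset (Finset.subset_univ S)]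
      · refine Finset.sum_congr rfl fun i hi => ?_
        rw [← Finset.sum_subset (Finset.subset_univ S)]
        · refine Finset.sum_congr rfl fun j hj => ?_
          simp [hi, hj, iv]
        · intro j _ hj
          simp [hj]
      · intro i _ hi
        simp [hi]

lemma sum_eps_Bf {n : ℕ} (σ : Equiv.Perm (Fin n)) (z : Fin n → ZMod 2) (hz : ¬ Rad σ z) :
    ∑ x : Fin n → ZMod 2, eps (Bf σ x z) = 0 := by
  unfold Rad at hz
  push Not at hz
  obtain ⟨x0, hx0⟩ := hz
  have h1 := zmod2_ne_zero hx0
  have h := Equiv.sum_comp (Equiv.addRight x0) (fun x => eps (Bf σ x z))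
  simp only [Equiv.coe_addRight, Bf_add_left, h1, eps_add, eps_one, mul_neg, mul_one,
    Finset.sum_neg_distrib] at h
  linarith

lemma signSum_eq_zero_iff {n : ℕ} (σ : Equiv.Perm (Fin n)) :
    signSum σ = 0 ↔ ∃ z, Rad σ z ∧ qf σ z = 1 := by
  classical
  rw [signSum_eq]
  constructor
  · intro hA
    by_contra hcon
    push Not at hcon
    have hq : ∀ z, Rad σ z → eps (qf σ z) = 1 := by
      intro z hz
      by_cases h0 : qf σ z = 0
      · rw [h0, eps_zero]
      · exact absurd (zmod2_ne_zero h0) (hcon z hz)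
    have hsq : (∑ x : Fin n → ZMod 2, eps (qf σ x)) * (∑ x : Fin n → ZMod 2, eps (qf σ x))
        = ∑ z : Fin n → ZMod 2, eps (qf σ z) * ∑ x : Fin n → ZMod 2, eps (Bf σ x z) := by
      rw [Finset.sum_mul]
      have : ∀ x : Fin n → ZMod 2, eps (qf σ x) * ∑ y : Fin n → ZMod 2, eps (qf σ y)
          = ∑ z : Fin n → ZMod 2, eps (qf σ z) * eps (Bf σ x z) := by
        intro x
        rw [← Equiv.sum_comp (Equiv.addLeft x) (fun y => eps (qf σ y)), Finset.mul_sum]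
        refine Finset.sum_congr rfl fun z _ => ?_
        simp only [Equiv.coe_addLeft]
        rw [← eps_add, ← eps_add, qf_add, ← add_assoc, ← add_assoc, CharTwo.add_self_eq_zero,
          zero_add]
      rw [Finset.sum_congr rfl fun x _ => this x, Finset.sum_comm]
      refine Finset.sum_congr rfl fun z _ => ?_
      rw [Finset.mul_sum]
    rw [hA, mul_zero] at hsq
    have hpos : 0 < ∑ z : Fin n → ZMod 2, eps (qf σ z) * ∑ x : Fin n → ZMod 2, eps (Bf σ x z) := by
      refine Finset.sum_pos' (fun z _ => ?_) ⟨0, Finset.mem_univ _, ?_⟩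
      · by_cases hz : Rad σ z
        · rw [hq z hz, one_mul]
          refine Finset.sum_nonneg fun x _ => ?_
          rw [hz x, eps_zero]; norm_num
        · rw [sum_eps_Bf σ z hz, mul_zero]
      · have hz : Rad σ 0 := by intro x; simp [Bf]
        rw [hq 0 hz, one_mul]
        simp only [hz _, eps_zero]
        simp
    omega
  · rintro ⟨z, hz, hqz⟩
    have h := Equiv.sum_comp (Equiv.addRight z) (fun x => eps (qf σ x))
    simp only [Equiv.coe_addRight, qf_add, hz _, hqz, add_zero, eps_add, eps_one, mul_neg, mul_one,
      Finset.sum_neg_distrib] at h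
    linarith

/-! ### Partial sums and the radical -/

def par {m : ℕ} (z : Fin m → ZMod 2) (k : Fin (m + 1)) : ZMod 2 :=
  ∑ j : Fin m, if j.castSucc < k then z j else 0

lemma par_zero {m : ℕ} (z : Fin m → ZMod 2) : par z 0 = 0 := by
  simp [par]

lemma par_last {m : ℕ} (z : Fin m → ZMod 2) : par z (Fin.last m) = ∑ j, z j := by
  simp [par, Fin.castSucc_lt_last]

lemma par_castSucc {m : ℕ} (z : Fin m → ZMod 2) (i : Fin m) :
    par z i.castSucc = ∑ j, if j < i then z j else 0 := by
  simp [par]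

lemma par_succ {m : ℕ} (z : Fin m → ZMod 2) (i : Fin m) :
    par z i.succ = par z i.castSucc + z i := by
  have : z i = ∑ j, if j = i then z j else 0 := by simp
  rw [this, par, par, ← Finset.sum_add_distrib]
  refine Finset.sum_congr rfl fun j _ => ?_
  simp only [Fin.castSucc_lt_succ_iff, Fin.castSucc_lt_castSucc_iff]
  rcases lt_trichotomy j i with h | h | h
  · simp [h, h.le, h.ne]
  · simp [h]
  · simp [h.not_ge, h.not_gt, h.ne']

/-- The coboundary of a function on gaps. -/
def zf {m : ℕ} (h : Fin (m + 1) → ZMod 2) (i : Fin m) : ZMod 2 := h i.castSucc + h i.succ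

lemma par_zf {m : ℕ} (h : Fin (m + 1) → ZMod 2) (k : Fin (m + 1)) :
    par (zf h) k = h 0 + h k := by
  refine Fin.induction ?_ (fun i ih => ?_) k
  · rw [par_zero, CharTwo.add_self_eq_zero]
  · rw [par_succ, ih, zf]
    have := CharTwo.add_self_eq_zero (h i.castSucc)
    linear_combination this

lemma zf_par {m : ℕ} (z : Fin m → ZMod 2) : zf (par z) = z := by
  funext i
  rw [zf, par_succ, ← add_assoc, CharTwo.add_self_eq_zero, zero_add]

lemma par_comp {m : ℕ} (σ : Equiv.Perm (Fin m)) (z : Fin m → ZMod 2) (i : Fin m) :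
    par (fun k => z (σ⁻¹ k)) (σ i).castSucc = ∑ j, if σ j < σ i then z j else 0 := by
  rw [par_castSucc, ← Equiv.sum_comp σ]
  simp

def InvH {n : ℕ} (σ : Equiv.Perm (Fin (n + 1))) (h : Fin (n + 2) → ZMod 2) : Prop :=
  ∀ x, h (gapP σ x) = h x

lemma Rad_zf {n : ℕ} (σ : Equiv.Perm (Fin (n + 1))) (h : Fin (n + 2) → ZMod 2) (hh : InvH σ h) :
    Rad σ (zf h) := by
  set h' : Fin (n + 2) → ZMod 2 := fun x => h ((hatP σ)⁻¹ x) with hh'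
  have e1 : ∀ x, h' (hatP σ x) = h x := by intro x; simp [hh']
  have e2 : ∀ x, h' (chkP σ x) = h x := by
    intro x
    have := e1 ((gapP σ)⁻¹ x)
    rw [← chkP_gapP] at this
    rw [← hh ((gapP σ)⁻¹ x)] at this
    simpa using this
  have e3 : zf h' = fun k => zf h (σ⁻¹ k) := by
    funext k
    have a1 := e1 (σ⁻¹ k).succ
    have a2 := e2 (σ⁻¹ k).castSucc
    rw [hatP_succ] at a1
    rw [chkP_castSucc] at a2
    have hk : σ (σ⁻¹ k) = k := by simp
    rw [hk] at a1 a2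
    rw [zf, zf, a1, a2]
  rw [Rad_iff]
  intro i
  rw [← par_castSucc, ← par_comp, ← e3, par_zf, par_zf]
  have a0 := e1 0
  rw [hatP_zero] at a0
  have a2 := e2 i.castSucc
  rw [chkP_castSucc] at a2
  rw [a0, a2, CharTwo.add_self_eq_zero]

lemma exists_zf {n : ℕ} (σ : Equiv.Perm (Fin (n + 1))) (z : Fin (n + 1) → ZMod 2)
    (hz : Rad σ z) : ∃ h, InvH σ h ∧ zf h = z := by
  refine ⟨par z, ?_, zf_par z⟩
  rw [Rad_iff] at hz
  set z' : Fin (n + 1) → ZMod 2 := fun k => z (σ⁻¹ k) with hz'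
  have e0 : ∀ i : Fin (n + 1), par z i.castSucc = par z' (σ i).castSucc := by
    intro i
    have := hz i
    rw [← par_castSucc, ← par_comp] at this
    exact CharTwo.add_eq_zero.1 this
  have e2 : ∀ x, par z' (chkP σ x) = par z x := by
    intro x
    refine Fin.lastCases ?_ (fun i => ?_) x
    · rw [chkP_last, par_last, par_last, ← Equiv.sum_comp σ]
      simp [hz']
    · rw [chkP_castSucc, e0]
  have e1 : ∀ x, par z' (hatP σ x) = par z x := by
    intro x
    refine Fin.cases ?_ (fun i => ?_) x
    · rw [hatP_zero, par_zero, par_zero]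
    · rw [hatP_succ, par_succ, par_succ, e0]
      simp [hz']
  intro x
  rw [← e2, chkP_gapP, e1]

lemma qf_zf {n : ℕ} (σ : Equiv.Perm (Fin (n + 1))) (h : Fin (n + 2) → ZMod 2) (hh : InvH σ h) :
    qf σ (zf h) = h 0 + h (Fin.last (n + 1)) +
      (Qf σ (fun i => h i.castSucc) + Qf σ (fun i => h i.succ)) := by
  have h1 : zf h = (fun i => h i.castSucc) + (fun i => h i.succ) := rfl
  have h2 := Rad_zf σ h hh (fun i => h i.castSucc)
  rw [h1, Bf_add_right, Bf_self, zero_add] at h2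
  rw [qf, ← par_last, par_zf, h1, Qf_add, h2, add_zero]

/-! ### The sign of a single gap cycle -/

lemma sign_of_transitive {k : ℕ} (hk : 0 < k) (π : Equiv.Perm (Fin k))
    (h : ∀ x y, π.SameCycle x y) : ((Equiv.Perm.sign π : ℤˣ) : ℤ) = (-1) ^ (k + 1) := by
  by_cases hx : ∃ x, π x ≠ x
  · obtain ⟨x, hx⟩ := hx
    have hc : π.IsCycle := ⟨x, hx, fun y _ => h x y⟩
    have hs : π.support = Finset.univ := by
      ext y
      simp only [Equiv.Perm.mem_support, Finset.mem_univ, iff_true]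
      rwa [Ne, ← (h x y).apply_eq_self_iff]
    rw [hc.sign, hs]
    simp [pow_succ]
  · push Not at hx
    have h1 : π = 1 := by ext x; simp [hx]
    have h2 : k = 1 := by
      by_contra hne
      have := (h ⟨0, hk⟩ ⟨1, by omega⟩).eq_of_left (hx _)
      simp at this
    subst h2
    simp [h1]

/-- Sign of the comparison of two elements. -/
def sg {m : ℕ} (a b : Fin m) : ℤ := if a < b then 1 else if b < a then -1 else 0

lemma sg_neg {m : ℕ} (a b : Fin m) : sg a b = - sg b a := by
  unfold sg
  rcases lt_trichotomy a b with h | h | h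
  · simp [h, h.not_gt]
  · simp [h]
  · simp [h, h.not_gt]

lemma prod_reindex {m : ℕ} (f : Finset (Fin m)) (T : Fin m → ℤ) (hT : ∀ b, b ∉ f → T b = 1) :
    ∏ b, T b = ∏ j : Fin f.card, T (f.orderIsoOfFin rfl j) := by
  rw [← Finset.prod_subset (Finset.subset_univ f) (fun b _ hb => hT b hb), ← Finset.prod_coe_sort]
  exact (Equiv.prod_comp (f.orderIsoOfFin rfl).toEquiv (fun b : f => T b)).symm

def ind {m : ℕ} (f : Finset (Fin m)) (a : Fin m) : ZMod 2 := if a ∈ f then 1 else 0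

lemma prod_sg {m : ℕ} (f : Finset (Fin m)) (g : Equiv.Perm (Fin m)) :
    ∏ j : Fin f.card, ∏ i ∈ Finset.Iio j,
      sg (g (f.orderIsoOfFin rfl i)) (g (f.orderIsoOfFin rfl j)) = eps (Qf g (ind f)) := by
  unfold Qf
  rw [Finset.sum_comm, eps_sum, prod_reindex f]
  · refine Finset.prod_congr rfl fun j _ => ?_
    rw [eps_sum, prod_reindex f]
    · rw [← Finset.prod_subset (Finset.subset_univ (Finset.Iio j))]
      · refine Finset.prod_congr rfl fun i hi => ?_
        rw [Finset.mem_Iio] at hi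
        have hlt : ((f.orderIsoOfFin rfl i : f) : Fin m) < (f.orderIsoOfFin rfl j : f) := by
          exact_mod_cast (f.orderIsoOfFin rfl).lt_iff_lt.2 hi
        have hne := fun e => hlt.ne (g.injective e)
        have m1 := (f.orderIsoOfFin rfl i).2
        have m2 := (f.orderIsoOfFin rfl j).2
        generalize ((f.orderIsoOfFin rfl i : f) : Fin m) = a at *
        generalize ((f.orderIsoOfFin rfl j : f) : Fin m) = b at *
        rcases lt_or_gt_of_ne hne with h | h
        · simp [sg, iv, ind, h, h.not_gt, eps_zero]
        · simp [sg, iv, ind, h, h.not_gt, eps_one, m1, m2, hlt]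
      · intro i _ hi
        rw [Finset.mem_Iio] at hi
        simp [iv, hi, eps_zero]
    · intro b hb
      simp [ind, hb, eps_zero]
  · intro b hb
    simp [ind, hb, eps_zero]

lemma Qf_hatP {n : ℕ} (σ : Equiv.Perm (Fin (n + 1))) (h : Fin (n + 2) → ZMod 2) :
    Qf (hatP σ) h = Qf σ (fun i => h i.succ) := by
  unfold Qf
  rw [Fin.sum_univ_succ]
  have h0 : ∀ j, iv (hatP σ) 0 j = 0 := by
    intro j; simp [iv, hatP_zero]
  have h1 : ∀ j, iv (hatP σ) j 0 = 0 := by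
    intro j; simp [iv]
  have h2 : ∀ i j : Fin (n + 1), iv (hatP σ) i.succ j.succ = iv σ i j := by
    intro i j; simp [iv, hatP_succ]
  simp only [h0, zero_mul, Finset.sum_const_zero, zero_add]
  refine Finset.sum_congr rfl fun i _ => ?_
  rw [Fin.sum_univ_succ, h1, zero_mul, zero_add]
  simp only [h2]

lemma Qf_chkP {n : ℕ} (σ : Equiv.Perm (Fin (n + 1))) (h : Fin (n + 2) → ZMod 2) :
    Qf (chkP σ) h = Qf σ (fun i => h i.castSucc) := by
  unfold Qf
  rw [Fin.sum_univ_castSucc]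
  have h0 : ∀ j, iv (chkP σ) (Fin.last (n + 1)) j = 0 := by
    intro j; simp [iv, Fin.le_last]
  have h1 : ∀ j, iv (chkP σ) j (Fin.last (n + 1)) = 0 := by
    intro j; simp [iv, chkP_last, Fin.le_last]
  have h2 : ∀ i j : Fin (n + 1), iv (chkP σ) i.castSucc j.castSucc = iv σ i j := by
    intro i j; simp [iv, chkP_castSucc]
  simp only [h0, zero_mul, Finset.sum_const_zero, add_zero]
  refine Finset.sum_congr rfl fun i _ => ?_
  rw [Fin.sum_univ_castSucc, h1, zero_mul, add_zero]
  simp only [h2]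

lemma gapP_mem_faceG {n : ℕ} (σ : Equiv.Perm (Fin (n + 1))) (x0 x : Fin (n + 2)) :
    gapP σ x ∈ faceG σ x0 ↔ x ∈ faceG σ x0 := by
  rw [mem_faceG, mem_faceG, Equiv.Perm.sameCycle_apply_right]

lemma invH_ind {n : ℕ} (σ : Equiv.Perm (Fin (n + 1))) (x0 : Fin (n + 2)) :
    InvH σ (ind (faceG σ x0)) := by
  intro x
  simp only [ind, gapP_mem_faceG]

lemma sign_face {n : ℕ} (σ : Equiv.Perm (Fin (n + 1))) (x0 : Fin (n + 2)) :
    eps (Qf (hatP σ) (ind (faceG σ x0))) =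
      (-1) ^ ((faceG σ x0).card + 1) * eps (Qf (chkP σ) (ind (faceG σ x0))) := by
  set f := faceG σ x0 with hf
  have hmem : ∀ x, gapP σ x ∈ f ↔ x ∈ f := gapP_mem_faceG σ x0
  set π : Equiv.Perm (Fin f.card) :=
    (f.orderIsoOfFin rfl).toEquiv.symm.permCongr ((gapP σ).subtypePerm hmem) with hπ
  have hπa : ∀ i, ((f.orderIsoOfFin rfl (π i) : f) : Fin (n + 2)) =
      gapP σ (f.orderIsoOfFin rfl i : f) := by
    intro i
    simp [hπ, Equiv.permCongr_apply]
  have hpow : ∀ (m : ℕ) (i), ((f.orderIsoOfFin rfl ((π ^ m) i) : f) : Fin (n + 2)) =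
      (gapP σ ^ m) (f.orderIsoOfFin rfl i : f) := by
    intro m
    induction m with
    | zero => intro i; rfl
    | succ k ih =>
      intro i
      rw [pow_succ', Equiv.Perm.mul_apply, hπa, ih, pow_succ', Equiv.Perm.mul_apply]
  have htr : ∀ x y, π.SameCycle x y := by
    intro x y
    have hx := (f.orderIsoOfFin rfl x).2
    have hy := (f.orderIsoOfFin rfl y).2
    have h : (gapP σ).SameCycle (f.orderIsoOfFin rfl x : f) (f.orderIsoOfFin rfl y : f) :=
      ((mem_faceG σ x0 _).1 hx).symm.trans ((mem_faceG σ x0 _).1 hy)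
    obtain ⟨m, hm⟩ := h.exists_nat_pow_eq
    rw [← hpow] at hm
    have := (f.orderIsoOfFin rfl).injective (Subtype.ext hm)
    exact ⟨m, by simpa using this⟩
  have hpos : 0 < f.card :=
    Finset.card_pos.2 ⟨x0, (mem_faceG σ x0 x0).2 (Equiv.Perm.SameCycle.refl _ _)⟩
  have hsign := sign_of_transitive hpos π htr
  have key := Equiv.Perm.prod_Iio_comp_eq_sign_mul_prod π
    (f := fun i j => sg (chkP σ (f.orderIsoOfFin rfl i : f)) (chkP σ (f.orderIsoOfFin rfl j : f)))
    (fun i j => sg_neg _ _)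
  simp only [hπa, chkP_gapP] at key
  rw [prod_sg, prod_sg] at key
  rw [key, ← hsign]
  simp

lemma qf_face {n : ℕ} (σ : Equiv.Perm (Fin (n + 1))) (x0 : Fin (n + 2)) :
    qf σ (zf (ind (faceG σ x0))) = ((faceLen σ (pullG σ (faceG σ x0)) + 1 : ℕ) : ZMod 2) := by
  rw [qf_zf σ _ (invH_ind σ x0), ← Qf_chkP, ← Qf_hatP]
  have h1 := faceLen_pullG σ (faceG σ x0) (gapP_mem_faceG σ x0)
  have h2 : ((faceG σ x0).card : ZMod 2) = (faceLen σ (pullG σ (faceG σ x0)) : ZMod 2) +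
      (ind (faceG σ x0) 0 + ind (faceG σ x0) (Fin.last (n + 1))) := by
    rw [← h1]
    push_cast
    rfl
  have h3 : Qf (hatP σ) (ind (faceG σ x0)) =
      (((faceG σ x0).card + 1 : ℕ) : ZMod 2) + Qf (chkP σ) (ind (faceG σ x0)) := by
    apply eps_inj
    rw [eps_add, eps_natCast, sign_face]
  rw [h3]
  push_cast
  rw [h2]
  generalize ind (faceG σ x0) 0 = a
  generalize ind (faceG σ x0) (Fin.last (n + 1)) = b
  generalize Qf (chkP σ) (ind (faceG σ x0)) = c
  generalize (faceLen σ (pullG σ (faceG σ x0)) : ZMod 2) = d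
  revert a b c d
  decide

/-! ### Assembling -/

lemma zf_add {m : ℕ} (h k : Fin (m + 1) → ZMod 2) : zf (h + k) = zf h + zf k := by
  funext i
  simp only [zf, Pi.add_apply]
  ring

lemma qf_zero {n : ℕ} (σ : Equiv.Perm (Fin n)) : qf σ 0 = 0 := by simp [qf, Qf]

lemma qf_zf_sum {n : ℕ} (σ : Equiv.Perm (Fin (n + 1))) (s : Finset (Finset (Fin (n + 2))))
    (hs : s ⊆ facesG σ) :
    qf σ (zf (∑ f ∈ s, ind f)) = ∑ f ∈ s, ((faceLen σ (pullG σ f) + 1 : ℕ) : ZMod 2) := by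
  induction s using Finset.induction_on with
  | empty =>
    have : zf (0 : Fin (n + 2) → ZMod 2) = 0 := by funext i; simp [zf]
    simp only [Finset.sum_empty]
    rw [this, qf_zero]
  | insert f s hf ih =>
    have hfm := hs (Finset.mem_insert_self f s)
    obtain ⟨x0, -, rfl⟩ := Finset.mem_image.1 hfm
    rw [Finset.sum_insert hf, Finset.sum_insert hf, add_comm (ind _), zf_add, qf_add,
      Rad_zf σ _ (invH_ind σ x0), ih fun g hg => hs (Finset.mem_insert_of_mem hg), qf_face]
    ring

lemma sum_ind {n : ℕ} (σ : Equiv.Perm (Fin (n + 1))) (h : Fin (n + 2) → ZMod 2) (hh : InvH σ h) :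
    ∑ f ∈ (Finset.univ.filter fun x => h x = 1).image (faceG σ), ind f = h := by
  have hc : ∀ x y, (gapP σ).SameCycle x y → h x = h y := by
    intro x y hxy
    obtain ⟨m, rfl⟩ := hxy.exists_nat_pow_eq
    clear hxy
    induction m with
    | zero => rfl
    | succ k ih => rw [pow_succ', Equiv.Perm.mul_apply, hh, ih]
  funext x
  rw [Finset.sum_apply]
  by_cases hx : h x = 1
  · rw [Finset.sum_eq_single (faceG σ x)]
    · rw [ind, if_pos ((mem_faceG σ x x).2 (Equiv.Perm.SameCycle.refl _ _)), hx]
    · intro g hg hne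
      obtain ⟨y, -, rfl⟩ := Finset.mem_image.1 hg
      rw [ind, if_neg]
      intro hm
      apply hne
      rw [mem_faceG] at hm
      ext z
      rw [mem_faceG, mem_faceG]
      exact ⟨hm.symm.trans, hm.trans⟩
    · intro hn
      exact absurd (Finset.mem_image_of_mem _ (by simpa using hx)) hn
  · have hx0 : h x = 0 := by
      by_contra h0
      exact hx (zmod2_ne_zero h0)
    rw [hx0]
    refine Finset.sum_eq_zero fun g hg => ?_
    obtain ⟨y, hy, rfl⟩ := Finset.mem_image.1 hg
    rw [ind, if_neg]
    intro hm
    rw [mem_faceG] at hm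
    apply hx
    rw [← hc y x hm]
    simpa using hy

lemma sum_ind_one {n : ℕ} (σ : Equiv.Perm (Fin (n + 1))) :
    ∑ f ∈ facesG σ, ind f = fun _ => 1 := by
  have := sum_ind σ (fun _ => 1) (fun _ => rfl)
  simpa [facesG] using this

lemma sum_len_succ {n : ℕ} (σ : Equiv.Perm (Fin (n + 1))) :
    ∑ f ∈ facesG σ, ((faceLen σ (pullG σ f) + 1 : ℕ) : ZMod 2) = 0 := by
  rw [← qf_zf_sum σ _ (Finset.Subset.refl _), sum_ind_one]
  have : zf (fun _ : Fin (n + 2) => (1 : ZMod 2)) = 0 := by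
    funext i
    rw [zf, CharTwo.add_self_eq_zero]; rfl
  rw [this, qf_zero]

lemma sum_len {n : ℕ} (σ : Equiv.Perm (Fin (n + 1))) :
    ∑ f ∈ facesG σ, (faceLen σ (pullG σ f) : ZMod 2) = (n : ZMod 2) := by
  have hx : ∀ x, ∑ f ∈ facesG σ, ind f x = 1 := by
    intro x
    have := congrFun (sum_ind_one σ) x
    rwa [Finset.sum_apply] at this
  have h1 : ∑ f ∈ facesG σ, ((faceLen σ (pullG σ f) : ZMod 2) +
      (ind f 0 + ind f (Fin.last (n + 1)))) = ∑ f ∈ facesG σ, ∑ x, ind f x := by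
    refine Finset.sum_congr rfl fun f hf => ?_
    obtain ⟨x0, -, rfl⟩ := Finset.mem_image.1 hf
    have h1 := faceLen_pullG σ (faceG σ x0) (gapP_mem_faceG σ x0)
    have h2 : ∑ x, ind (faceG σ x0) x = ((faceG σ x0).card : ZMod 2) := by
      simp [ind]
    rw [h2, ← h1]
    push_cast
    rfl
  rw [Finset.sum_comm, Finset.sum_congr rfl fun x _ => hx x] at h1
  rw [Finset.sum_add_distrib, Finset.sum_add_distrib, hx, hx] at h1
  simp only [Finset.sum_const, Finset.card_univ, Fintype.card_fin, nsmul_eq_mul, mul_one] at h1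
  push_cast at h1
  linear_combination h1

/-- **Parity and sign constraints.** The number of even cycle lengths (with multiplicity) is
even; equivalently `n - |λ(σ)|` is odd (here the size is `n + 1`). Moreover `s(σ) = 0` iff
`λ(σ)` contains an even element. -/
theorem parity_and_sign (n : ℕ) (σ : Equiv.Perm (Fin (n + 1))) :
    Even (Multiset.card ((cycleInv σ).filter fun ℓ => Even ℓ)) ∧
    Odd ((n + 1 : ℤ) - Multiset.card (cycleInv σ)) ∧
    (signInv σ = 0 ↔ ∃ ℓ ∈ cycleInv σ, Even ℓ) := by
  have hodd : ∀ m : ℕ, ((m + 1 : ℕ) : ZMod 2) = if Even m then 1 else 0 := by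
    intro m
    split_ifs with h
    · rw [ZMod.natCast_eq_one_iff_odd]; exact h.add_one
    · rw [ZMod.natCast_eq_zero_iff_even]
      exact (Nat.not_even_iff_odd.1 h).add_one
  refine ⟨?_, ?_, ?_⟩
  · rw [cycleInv_eq, Multiset.filter_map, Multiset.card_map]
    have h := sum_len_succ σ
    rw [Finset.sum_congr rfl fun f _ => hodd _, Finset.sum_boole,
      ZMod.natCast_eq_zero_iff_even] at h
    exact h
  · rw [cycleInv_eq, Multiset.card_map]
    have h := sum_len_succ σ
    push_cast at h
    rw [Finset.sum_add_distrib, sum_len, Finset.sum_const, nsmul_eq_mul, mul_one] at h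
    have h' : Even (n + (facesG σ).card) := by
      rw [← ZMod.natCast_eq_zero_iff_even]; push_cast; exact h
    have e : (facesG σ).val.card = (facesG σ).card := rfl
    rw [e]
    obtain ⟨r, hr⟩ := h'
    exact ⟨(n : ℤ) - r, by omega⟩
  · rw [signInv, Int.sign_eq_zero_iff_zero, signSum_eq_zero_iff, cycleInv_eq]
    constructor
    · rintro ⟨z, hz, hq⟩
      obtain ⟨h, hh, rfl⟩ := exists_zf σ z hz
      by_contra hcon
      push Not at hcon
      rw [← sum_ind σ h hh, qf_zf_sum] at hq
      · rw [Finset.sum_eq_zero] at hq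
        · exact absurd hq (by decide)
        · intro f hf
          rw [hodd, if_neg]
          apply hcon
          refine Multiset.mem_map.2 ⟨f, ?_, rfl⟩
          obtain ⟨y, -, rfl⟩ := Finset.mem_image.1 hf
          exact Finset.mem_image_of_mem _ (Finset.mem_univ y)
      · exact Finset.image_subset_image (Finset.subset_univ _)
    · rintro ⟨ℓ, hℓ, hev⟩
      obtain ⟨f, hf, rfl⟩ := Multiset.mem_map.1 hℓ
      have hf' : f ∈ facesG σ := hf
      obtain ⟨x0, -, rfl⟩ := Finset.mem_image.1 hf'
      refine ⟨_, Rad_zf σ _ (invH_ind σ x0), ?_⟩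
      rw [qf_face, hodd, if_pos hev]

end Rauzy
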